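/- arXiv:0911.1230 — 3 statements merged into one kernel-verified Lean document; each statement's English description precedes it below -/
import Mathlib

section
/- For every s ∈ ℂ with Re s > 0, all the integrals below converge absolutely and ∫₂^∞ θ^{1/2−s} ((θ−1)^{−3/2} − θ^{−3/2}) dθ + ∫_{1/2}^1 (1−θ)^{−3/2} (θ^{s−1} − 1) dθ + 2^{−s}/s − 2√2 = −2√π · Γ(s)/Γ(s − 1/2), where for θ > 0 the powers θ^{z} are defined via the real logarithm of θ. -/
open MeasureTheory Real Set Filter

theorem hasDerivAt_ofReal_one_sub_rpow_neg_half {x : ℝ} (hx : x < 1) :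
    HasDerivAt (fun y : ℝ => (((1 - y) ^ (-(1:ℝ)/2) : ℝ) : ℂ))
      ((((1 - x) ^ (-(3:ℝ)/2) : ℝ) : ℂ) / 2) x := by
  have h := (((hasDerivAt_id x).const_sub 1).rpow_const (p := -(1:ℝ)/2)
    (Or.inl (by simpa using (sub_pos.2 hx).ne'))).ofReal_comp
  refine h.congr_deriv ?_
  rw [show (-(1:ℝ)/2 - 1) = -(3:ℝ)/2 by norm_num]
  push_cast
  simp only [id]
  ring

theorem hasDerivAt_cpow_mul_one_sub_rpow {s : ℂ} (hs : s ≠ 0) {x : ℝ} (h0 : 0 < x) (h1 : x < 1) :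
    HasDerivAt (fun y : ℝ => (y : ℂ) ^ s * (((1 - y) ^ (-(1:ℝ)/2) : ℝ) : ℂ))
      (((x : ℂ) ^ (s - 1) * (((1 - x) ^ (-(3:ℝ)/2) : ℝ) : ℂ)
        - (1 - 2 * s) * ((x : ℂ) ^ (s - 1) * (((1 - x) ^ (-(1:ℝ)/2) : ℝ) : ℂ))) / 2) x := by
  have h := (hasDerivAt_ofReal_cpow_const h0.ne' hs).mul
    (hasDerivAt_ofReal_one_sub_rpow_neg_half h1)
  refine h.congr_deriv ?_
  have hx : (x : ℂ) ^ s = (x : ℂ) ^ (s - 1) * x := by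
    rw [Complex.cpow_sub _ _ (by exact_mod_cast h0.ne'), Complex.cpow_one,
      div_mul_cancel₀ _ (by exact_mod_cast h0.ne')]
  have hw : (1 - x) ^ (-(1:ℝ)/2) = (1 - x) ^ (-(3:ℝ)/2) * (1 - x) := by
    rw [← Real.rpow_add_one (sub_pos.2 h1).ne']
    norm_num
  rw [hx, hw]
  push_cast
  ring

theorem exists_norm_cpow_sub_one_le (z : ℂ) :
    ∃ C : ℝ, ∀ x ∈ Icc (1/2 : ℝ) 1, ‖(x : ℂ) ^ z - 1‖ ≤ C * (1 - x) := by
  rcases eq_or_ne z 0 with rfl | hz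
  · exact ⟨0, by simp⟩
  have hpos : ∀ x ∈ Icc (1/2 : ℝ) 1, x ≠ 0 := fun x hx => by
    have := hx.1
    intro h
    norm_num [h] at this
  have hcont : ContinuousOn (fun x : ℝ => z * (x : ℂ) ^ (z - 1)) (Icc (1/2 : ℝ) 1) :=
    fun x hx => (continuousAt_const.mul
      (Complex.continuousAt_ofReal_cpow_const x _ (Or.inr (hpos x hx)))).continuousWithinAt
  obtain ⟨C, hC⟩ := isCompact_Icc.exists_bound_of_continuousOn hcont
  refine ⟨C, fun x hx => ?_⟩
  have h := Convex.norm_image_sub_le_of_norm_hasDerivWithin_le (𝕜 := ℝ)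
    (fun y hy => (hasDerivAt_ofReal_cpow_const (hpos y hy) hz).hasDerivWithinAt) hC
    (convex_Icc _ _) (right_mem_Icc.2 (by norm_num)) hx
  simpa [norm_sub_rev x 1, abs_of_nonneg (sub_nonneg.2 hx.2)] using h

theorem ofReal_one_sub_rpow_neg_half {x : ℝ} (hx : x ≤ 1) :
    (((1 - x) ^ (-(1:ℝ)/2) : ℝ) : ℂ) = (1 - (x : ℂ)) ^ ((1/2 : ℂ) - 1) := by
  rw [Complex.ofReal_cpow (sub_nonneg.2 hx)]
  congr 1
  · push_cast; ring
  · push_cast; ring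

theorem intervalIntegrable_cpow_mul_one_sub_rpow {s : ℂ} (hs : 0 < s.re) :
    IntervalIntegrable (fun x : ℝ => (x : ℂ) ^ (s - 1) * (((1 - x) ^ (-(1:ℝ)/2) : ℝ) : ℂ))
      volume 0 1 := by
  refine (Complex.betaIntegral_convergent (v := 1/2) hs (by norm_num)).congr fun x hx => ?_
  rw [uIoc_of_le zero_le_one] at hx
  simp only [ofReal_one_sub_rpow_neg_half hx.2]

theorem integral_cpow_mul_one_sub_rpow (s : ℂ) :
    ∫ x in (0:ℝ)..1, (x : ℂ) ^ (s - 1) * (((1 - x) ^ (-(1:ℝ)/2) : ℝ) : ℂ)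
      = Complex.betaIntegral s (1/2) := by
  refine intervalIntegral.integral_congr fun x hx => ?_
  rw [uIcc_of_le zero_le_one] at hx
  simp only [ofReal_one_sub_rpow_neg_half hx.2]

theorem one_sub_two_mul_mul_betaIntegral_half {s : ℂ} (hs : 0 < s.re) :
    (1 - 2 * s) * Complex.betaIntegral s (1/2)
      = -2 * Real.sqrt Real.pi * Complex.Gamma s / Complex.Gamma (s - 1/2) := by
  rcases eq_or_ne (s - 1/2) 0 with h | h
  · rw [h, Complex.Gamma_zero, div_zero, show 1 - 2 * s = -2 * (s - 1/2) by ring, h]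
    simp
  have hb := Complex.Gamma_mul_Gamma_eq_betaIntegral (t := 1/2) hs (by norm_num)
  have hg := Complex.Gamma_add_one _ h
  have hne : Complex.Gamma (s + 1/2) ≠ 0 :=
    Complex.Gamma_ne_zero_of_re_pos (by norm_num; linarith)
  rw [show s - 1/2 + 1 = s + 1/2 by ring] at hg
  have hne' : Complex.Gamma (s - 1/2) ≠ 0 := fun h0 => hne (by rw [hg, h0, mul_zero])
  have hpi : Complex.Gamma (1/2) = (Real.sqrt Real.pi : ℂ) := by
    rw [← Real.Gamma_one_half_eq, ← Complex.Gamma_ofReal]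
    norm_num
  rw [hpi, hg] at hb
  rw [eq_div_iff hne']
  linear_combination 2 * hb

theorem intervalIntegrable_cpow_mul_one_sub_rpow_sub_one {s : ℂ} (hs : 0 < s.re) :
    IntervalIntegrable
      (fun x : ℝ => (x : ℂ) ^ (s - 1) * (((1 - x) ^ (-(3:ℝ)/2) - 1 : ℝ) : ℂ)) volume 0 (1/2) := by
  refine (intervalIntegral.intervalIntegrable_cpow' (by simpa using hs)).mul_continuousOn ?_
  refine Complex.continuous_ofReal.comp_continuousOn ?_
  refine ContinuousOn.sub (ContinuousOn.rpow_const (by fun_prop) fun x hx => Or.inl ?_)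
    continuousOn_const
  rw [uIcc_of_le (by norm_num)] at hx
  linarith [hx.2]

theorem intervalIntegrable_one_sub_rpow_mul_cpow_sub_one (s : ℂ) :
    IntervalIntegrable
      (fun x : ℝ => (((1 - x) ^ (-(3:ℝ)/2) : ℝ) : ℂ) * ((x : ℂ) ^ (s - 1) - 1))
      volume (1/2) 1 := by
  obtain ⟨C, hC⟩ := exists_norm_cpow_sub_one_le (s - 1)
  rw [intervalIntegrable_iff_integrableOn_Ioo_of_le (by norm_num)]
  have hw : IntervalIntegrable (fun x : ℝ => (1 - x) ^ (-(1:ℝ)/2)) volume (1/2) 1 := by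
    have := (intervalIntegral.intervalIntegrable_rpow' (a := 1/2) (b := 0) (r := -(1:ℝ)/2)
      (by norm_num)).comp_sub_left 1
    norm_num at this ⊢
    exact this
  rw [intervalIntegrable_iff_integrableOn_Ioo_of_le (by norm_num)] at hw
  refine (hw.const_mul C).mono' ?_ ?_
  · refine ContinuousOn.aestronglyMeasurable (fun x hx => ?_) measurableSet_Ioo
    have h0 : x ≠ 0 := by linarith [hx.1]
    have h1 : 1 - x ≠ 0 := by linarith [hx.2]
    refine ContinuousAt.continuousWithinAt (ContinuousAt.mul ?_
      ((Complex.continuousAt_ofReal_cpow_const x _ (Or.inr h0)).sub continuousAt_const))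
    exact Complex.continuous_ofReal.continuousAt.comp
      (ContinuousAt.rpow_const (by fun_prop) (Or.inl h1))
  · filter_upwards [ae_restrict_mem measurableSet_Ioo] with x hx
    have h1 : 0 < 1 - x := sub_pos.2 hx.2
    rw [norm_mul, Complex.norm_real, Real.norm_of_nonneg (rpow_nonneg h1.le _)]
    calc _ ≤ (1 - x) ^ (-(3:ℝ)/2) * (C * (1 - x)) :=
          mul_le_mul_of_nonneg_left (hC x ⟨hx.1.le, hx.2.le⟩) (rpow_nonneg h1.le _)
      _ = C * ((1 - x) ^ (-(3:ℝ)/2) * (1 - x)) := by ring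
      _ = C * (1 - x) ^ (-(1:ℝ)/2) := by
          rw [← Real.rpow_add_one h1.ne']
          norm_num

theorem one_sub_half_rpow_neg_half : (1 - 1/2 : ℝ) ^ (-(1:ℝ)/2) = Real.sqrt 2 := by
  rw [show (1 - 1/2 : ℝ) = 2⁻¹ by norm_num, Real.inv_rpow zero_le_two, ← Real.rpow_neg zero_le_two,
    Real.sqrt_eq_rpow]
  norm_num

theorem ofReal_half_cpow (s : ℂ) : ((1/2 : ℝ) : ℂ) ^ s = 2 ^ (-s) := by
  rw [Complex.cpow_neg, ← Complex.inv_cpow _ _ (by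
    rw [show (2 : ℂ) = ((2 : ℝ) : ℂ) by norm_num, Complex.arg_ofReal_of_nonneg zero_le_two]
    exact Real.pi_pos.ne)]
  norm_num

theorem integral_cpow_mul_one_sub_rpow_sub_one {s : ℂ} (hs : 0 < s.re) :
    ∫ x in (0:ℝ)..(1/2), (x : ℂ) ^ (s - 1) * (((1 - x) ^ (-(3:ℝ)/2) - 1 : ℝ) : ℂ)
      = (1 - 2 * s) * (∫ x in (0:ℝ)..(1/2),
          (x : ℂ) ^ (s - 1) * (((1 - x) ^ (-(1:ℝ)/2) : ℝ) : ℂ))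
        + (2 * 2 ^ (-s) * Real.sqrt 2 - 2 ^ (-s) / s) := by
  have hs0 : s ≠ 0 := by
    rintro rfl
    simp at hs
  have hA := intervalIntegrable_cpow_mul_one_sub_rpow_sub_one hs
  have hB := ((intervalIntegrable_cpow_mul_one_sub_rpow hs).mono_set (c := 0) (d := 1/2)
    (by rw [uIcc_of_le (by norm_num), uIcc_of_le (by norm_num)]
        exact Icc_subset_Icc_right (by norm_num))).const_mul (1 - 2 * s)
  have hcont : ∀ x : ℝ, x < 1 → ContinuousAt (fun x : ℝ =>
      2 * ((x : ℂ) ^ s * (((1 - x) ^ (-(1:ℝ)/2) : ℝ) : ℂ)) - (x : ℂ) ^ s / s) x := by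
    intro x hx
    have hc := Complex.continuousAt_ofReal_cpow_const x s (Or.inl hs)
    exact (continuousAt_const.mul (hc.mul
      (hasDerivAt_ofReal_one_sub_rpow_neg_half hx).continuousAt)).sub (hc.div_const s)
  have hF := intervalIntegral.integral_eq_sub_of_hasDerivAt_of_tendsto (by norm_num)
    (fun x hx => ?_) (hA.sub hB)
    ((hcont 0 (by norm_num)).tendsto.mono_left nhdsWithin_le_nhds)
    ((hcont (1/2) (by norm_num)).tendsto.mono_left nhdsWithin_le_nhds)
  · rw [intervalIntegral.integral_sub hA hB, intervalIntegral.integral_const_mul,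
      one_sub_half_rpow_neg_half, ofReal_half_cpow, Complex.ofReal_zero,
      Complex.zero_cpow hs0] at hF
    linear_combination hF
  · refine (((hasDerivAt_cpow_mul_one_sub_rpow hs0 hx.1 (by linarith [hx.2])).const_mul 2).sub
      ((hasDerivAt_ofReal_cpow_const hx.1.ne' hs0).div_const s)).congr_deriv ?_
    rw [mul_div_cancel_left₀ _ hs0]
    push_cast
    ring

theorem tendsto_cpow_sub_one_mul_one_sub_rpow (s : ℂ) :
    Tendsto (fun x : ℝ => 2 * (((x : ℂ) ^ s - 1) * (((1 - x) ^ (-(1:ℝ)/2) : ℝ) : ℂ)))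
      (nhdsWithin 1 (Iio 1)) (nhds 0) := by
  obtain ⟨C, hC⟩ := exists_norm_cpow_sub_one_le s
  have hlim : Tendsto (fun x : ℝ => 2 * (C * (1 - x) ^ (1/2 : ℝ))) (nhdsWithin 1 (Iio 1))
      (nhds 0) := by
    have : ContinuousAt (fun x : ℝ => 2 * (C * (1 - x) ^ (1/2 : ℝ))) 1 :=
      continuousAt_const.mul (continuousAt_const.mul
        (ContinuousAt.rpow_const (by fun_prop) (Or.inr (by norm_num))))
    simpa using this.tendsto.mono_left nhdsWithin_le_nhds
  refine squeeze_zero_norm' ?_ hlim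
  filter_upwards [Ioo_mem_nhdsLT (show (1/2 : ℝ) < 1 by norm_num)] with x hx
  have h1 : 0 < 1 - x := sub_pos.2 hx.2
  rw [norm_mul, norm_mul, Complex.norm_real, Real.norm_of_nonneg (rpow_nonneg h1.le _),
    Complex.norm_ofNat]
  gcongr 2 * ?_
  calc _ ≤ C * (1 - x) * (1 - x) ^ (-(1:ℝ)/2) :=
        mul_le_mul_of_nonneg_right (hC x ⟨hx.1.le, hx.2.le⟩) (rpow_nonneg h1.le _)
    _ = C * ((1 - x) ^ (-(1:ℝ)/2) * (1 - x)) := by ring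
    _ = C * (1 - x) ^ (1/2 : ℝ) := by
        rw [← Real.rpow_add_one h1.ne']
        norm_num

theorem integral_one_sub_rpow_mul_cpow_sub_one {s : ℂ} (hs : 0 < s.re) :
    ∫ x in (1/2 : ℝ)..1, (((1 - x) ^ (-(3:ℝ)/2) : ℝ) : ℂ) * ((x : ℂ) ^ (s - 1) - 1)
      = (1 - 2 * s) * (∫ x in (1/2 : ℝ)..1,
          (x : ℂ) ^ (s - 1) * (((1 - x) ^ (-(1:ℝ)/2) : ℝ) : ℂ))
        - 2 * ((2 ^ (-s) - 1) * Real.sqrt 2) := by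
  have hs0 : s ≠ 0 := by
    rintro rfl
    simp at hs
  have hA := intervalIntegrable_one_sub_rpow_mul_cpow_sub_one s
  have hB := ((intervalIntegrable_cpow_mul_one_sub_rpow hs).mono_set (c := 1/2) (d := 1)
    (by rw [uIcc_of_le (by norm_num), uIcc_of_le (by norm_num)]
        exact Icc_subset_Icc_left (by norm_num))).const_mul (1 - 2 * s)
  have hderiv : ∀ x ∈ Ico (1/2 : ℝ) 1, HasDerivAt
      (fun x : ℝ => 2 * (((x : ℂ) ^ s - 1) * (((1 - x) ^ (-(1:ℝ)/2) : ℝ) : ℂ)))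
      ((((1 - x) ^ (-(3:ℝ)/2) : ℝ) : ℂ) * ((x : ℂ) ^ (s - 1) - 1)
        - (1 - 2 * s) * ((x : ℂ) ^ (s - 1) * (((1 - x) ^ (-(1:ℝ)/2) : ℝ) : ℂ))) x := by
    intro x hx
    have h := ((hasDerivAt_cpow_mul_one_sub_rpow hs0 (by linarith [hx.1]) hx.2).sub
      (hasDerivAt_ofReal_one_sub_rpow_neg_half hx.2)).const_mul 2
    refine (h.congr_deriv (by ring)).congr_of_eventuallyEq (Eventually.of_forall fun y => ?_)
    simp only [Pi.sub_apply]
    ring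
  have hF := intervalIntegral.integral_eq_sub_of_hasDerivAt_of_tendsto (by norm_num)
    (fun x hx => hderiv x (Ioo_subset_Ico_self hx)) (hA.sub hB)
    ((hderiv (1/2) ⟨le_rfl, by norm_num⟩).continuousAt.tendsto.mono_left nhdsWithin_le_nhds)
    (tendsto_cpow_sub_one_mul_one_sub_rpow s)
  rw [intervalIntegral.integral_sub hA hB, intervalIntegral.integral_const_mul,
    one_sub_half_rpow_neg_half, ofReal_half_cpow] at hF
  linear_combination hF

theorem image_inv_Ioo_zero_half : (fun x : ℝ => x⁻¹) '' Ioo 0 (1/2) = Ioi 2 := by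
  ext y
  constructor
  · rintro ⟨x, hx, rfl⟩
    have := inv_strictAnti₀ hx.1 hx.2
    simpa using this
  · intro hy
    have hy' : (2:ℝ) < y := hy
    refine ⟨y⁻¹, ⟨by positivity, ?_⟩, inv_inv y⟩
    simpa using inv_strictAnti₀ two_pos hy'

theorem hasDerivWithinAt_inv_Ioo_zero_half :
    ∀ x ∈ Ioo (0:ℝ) (1/2), HasDerivWithinAt (fun x : ℝ => x⁻¹) (-(x ^ 2)⁻¹) (Ioo 0 (1/2)) x :=
  fun _ hx => (hasDerivAt_inv hx.1.ne').hasDerivWithinAt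

theorem abs_deriv_inv_smul_mellin_integrand (s : ℂ) {x : ℝ} (hx : x ∈ Ioo (0:ℝ) (1/2)) :
    |-(x ^ 2)⁻¹| • (((x⁻¹ : ℝ) : ℂ) ^ ((1:ℂ)/2 - s)
        * (((x⁻¹ - 1) ^ (-(3:ℝ)/2) - x⁻¹ ^ (-(3:ℝ)/2) : ℝ) : ℂ))
      = (x : ℂ) ^ (s - 1) * (((1 - x) ^ (-(3:ℝ)/2) - 1 : ℝ) : ℂ) := by
  have h0 : 0 < x := hx.1
  have h1 : 0 ≤ 1 - x := by linarith [hx.2]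
  have hx0 : (x : ℂ) ≠ 0 := by exact_mod_cast h0.ne'
  have harg : (x : ℂ).arg ≠ Real.pi := by
    rw [Complex.arg_ofReal_of_nonneg h0.le]
    exact Real.pi_pos.ne
  have hinv : x⁻¹ ^ (-(3:ℝ)/2) = x ^ (3/2 : ℝ) := by
    rw [Real.inv_rpow h0.le, ← Real.rpow_neg h0.le]
    norm_num
  have hsub : (x⁻¹ - 1) ^ (-(3:ℝ)/2) = x ^ (3/2 : ℝ) * (1 - x) ^ (-(3:ℝ)/2) := by
    rw [show x⁻¹ - 1 = x⁻¹ * (1 - x) by field_simp, Real.mul_rpow (by positivity) h1, hinv]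
  have hpow : (x : ℂ) ^ (s - 1/2) * (x : ℂ) ^ (3/2 : ℂ) = (x : ℂ) ^ (s - 1) * (x : ℂ) ^ 2 := by
    rw [← Complex.cpow_natCast, ← Complex.cpow_add _ _ hx0, ← Complex.cpow_add _ _ hx0]
    congr 1
    push_cast
    ring
  rw [hsub, hinv, abs_neg, abs_of_pos (by positivity), Complex.real_smul, Complex.ofReal_inv x,
    Complex.inv_cpow _ _ harg, ← Complex.cpow_neg, neg_sub]
  push_cast [Complex.ofReal_cpow h0.le]
  rw [show ((x : ℂ) ^ 2)⁻¹ * ((x : ℂ) ^ (s - 1/2) * ((x : ℂ) ^ (3/2 : ℂ)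
      * (((1 - x) ^ (-(3:ℝ)/2) : ℝ) : ℂ) - (x : ℂ) ^ (3/2 : ℂ)))
    = ((x : ℂ) ^ 2)⁻¹ * ((x : ℂ) ^ (s - 1/2) * (x : ℂ) ^ (3/2 : ℂ))
      * ((((1 - x) ^ (-(3:ℝ)/2) : ℝ) : ℂ) - 1) by ring, hpow]
  field_simp

theorem mellin_multiplier_integral_identity (s : ℂ) (hs : 0 < s.re) :
    IntegrableOn (fun θ : ℝ =>
        (θ : ℂ) ^ ((1:ℂ)/2 - s) * (((θ - 1) ^ (-(3:ℝ)/2) - θ ^ (-(3:ℝ)/2) : ℝ) : ℂ))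
      (Ioi 2) ∧
    IntegrableOn (fun θ : ℝ =>
        (((1 - θ) ^ (-(3:ℝ)/2) : ℝ) : ℂ) * ((θ : ℂ) ^ (s - 1) - 1))
      (Ioo (1/2 : ℝ) 1) ∧
    (∫ θ in Ioi (2:ℝ),
        (θ : ℂ) ^ ((1:ℂ)/2 - s) * (((θ - 1) ^ (-(3:ℝ)/2) - θ ^ (-(3:ℝ)/2) : ℝ) : ℂ))
      + (∫ θ in Ioo (1/2 : ℝ) 1,
          (((1 - θ) ^ (-(3:ℝ)/2) : ℝ) : ℂ) * ((θ : ℂ) ^ (s - 1) - 1))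
      + (2 : ℂ) ^ (-s) / s - 2 * Real.sqrt 2
      = -2 * Real.sqrt Real.pi * Complex.Gamma s / Complex.Gamma (s - 1/2) := by
  have hinj : InjOn (fun x : ℝ => x⁻¹) (Ioo 0 (1/2)) := inv_injective.injOn
  have hI₁ := intervalIntegrable_cpow_mul_one_sub_rpow_sub_one hs
  have hI₂ := intervalIntegrable_one_sub_rpow_mul_cpow_sub_one s
  rw [intervalIntegrable_iff_integrableOn_Ioo_of_le (by norm_num)] at hI₁ hI₂
  refine ⟨?_, hI₂, ?_⟩
  · rw [← image_inv_Ioo_zero_half, integrableOn_image_iff_integrableOn_abs_deriv_smul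
      measurableSet_Ioo hasDerivWithinAt_inv_Ioo_zero_half hinj]
    exact hI₁.congr_fun (fun x hx => (abs_deriv_inv_smul_mellin_integrand s hx).symm)
      measurableSet_Ioo
  · rw [← image_inv_Ioo_zero_half, integral_image_eq_integral_abs_deriv_smul
      measurableSet_Ioo hasDerivWithinAt_inv_Ioo_zero_half hinj,
      setIntegral_congr_fun measurableSet_Ioo
        (fun x hx => abs_deriv_inv_smul_mellin_integrand s hx),
      ← integral_Ioc_eq_integral_Ioo, ← integral_Ioc_eq_integral_Ioo,
      ← intervalIntegral.integral_of_le (by norm_num),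
      ← intervalIntegral.integral_of_le (by norm_num),
      integral_cpow_mul_one_sub_rpow_sub_one hs, integral_one_sub_rpow_mul_cpow_sub_one hs,
      ← one_sub_two_mul_mul_betaIntegral_half hs, ← integral_cpow_mul_one_sub_rpow]
    have hb := intervalIntegrable_cpow_mul_one_sub_rpow hs
    rw [← intervalIntegral.integral_add_adjacent_intervals (a := 0) (b := 1/2) (c := 1)
      (hb.mono_set (by
        rw [uIcc_of_le (by norm_num), uIcc_of_le (by norm_num)]
        exact Icc_subset_Icc_right (by norm_num)))
      (hb.mono_set (by
        rw [uIcc_of_le (by norm_num), uIcc_of_le (by norm_num)]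
        exact Icc_subset_Icc_left (by norm_num)))]
    ring
end

section
/- Let M(s) = −2√π · Γ(s)/Γ(s − 1/2). For every ε₀ ∈ (0, π) there exist constants C > 0 and R > 0 such that |M(s) + 2√(π s) · (1 − 3/(8s))| ≤ C |s|^{−3/2} for all s ∈ ℂ with |s| ≥ R and |arg s| ≤ π − ε₀, where √ denotes the principal branch of the square root. -/
open MeasureTheory Real Set Filter

/-- The Mellin multiplier `M(s) = -2√π Γ(s)/Γ(s - 1/2)`. -/
noncomputable def Mfun (s : ℂ) : ℂ :=
  -2 * Real.sqrt Real.pi * Complex.Gamma s / Complex.Gamma (s - 1/2)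

theorem ofReal_mul_cpow {r : ℝ} (hr : 0 < r) {z : ℂ} (hz : z ≠ 0) (a : ℂ) :
    ((r : ℂ) * z) ^ a = (r : ℂ) ^ a * z ^ a := by
  have hr' : (r : ℂ) ≠ 0 := by exact_mod_cast hr.ne'
  rw [Complex.cpow_def_of_ne_zero (mul_ne_zero hr' hz), Complex.cpow_def_of_ne_zero hr',
    Complex.cpow_def_of_ne_zero hz, Complex.log_ofReal_mul hr hz, ← Complex.exp_add,
    Complex.ofReal_log hr.le, add_mul]

theorem cpow_half_sq (z : ℂ) : (z ^ ((1 : ℂ) / 2)) ^ 2 = z := by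
  rw [one_div]
  exact Complex.cpow_ofNat_inv_pow z 2

theorem cpow_half_re_pos {z : ℂ} (hz : z ∈ Complex.slitPlane) :
    0 < (z ^ ((1 : ℂ) / 2)).re := by
  rw [one_div, Complex.cpow_inv_two_re]
  apply Real.sqrt_pos.2
  have h1 : -z.re ≤ ‖z‖ := (neg_le_abs _).trans (Complex.abs_re_le_norm z)
  have h2 : -z.re ≠ ‖z‖ := by
    intro h
    have h3 := Complex.sq_norm z
    rw [← h, Complex.normSq_apply] at h3
    have h4 : z.im = 0 := by nlinarith
    rcases Complex.mem_slitPlane_iff.1 hz with h5 | h5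
    · linarith [norm_nonneg z]
    · exact h5 h4
  have := lt_of_le_of_ne h1 h2
  linarith

theorem add_one_mem_slitPlane {z : ℂ} (hz : z ∈ Complex.slitPlane) :
    z + 1 ∈ Complex.slitPlane := by
  rw [Complex.mem_slitPlane_iff] at *
  simp only [Complex.add_re, Complex.one_re, Complex.add_im, Complex.one_im, add_zero]
  rcases hz with h | h
  · left; linarith
  · right; exact h

theorem add_natCast_mem_slitPlane {z : ℂ} (hz : z ∈ Complex.slitPlane) (n : ℕ) :
    z + n ∈ Complex.slitPlane := by
  induction n with
  | zero => simpa using hz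
  | succ n ih => simpa [add_assoc] using add_one_mem_slitPlane ih

theorem cpow_half_ratio_re_pos {z : ℂ} (hz : z ∈ Complex.slitPlane) :
    0 < ((z + 1) ^ ((1 : ℂ) / 2) / z ^ ((1 : ℂ) / 2)).re := by
  have ha := cpow_half_re_pos (add_one_mem_slitPlane hz)
  have hb := cpow_half_re_pos hz
  have him : 0 ≤ ((z + 1) ^ ((1 : ℂ) / 2)).im * (z ^ ((1 : ℂ) / 2)).im := by
    have him' : (z + 1).im = z.im := by simp
    rw [one_div]
    rcases le_or_gt 0 z.im with h | h
    · rw [Complex.cpow_inv_two_im_eq_sqrt h, Complex.cpow_inv_two_im_eq_sqrt (him' ▸ h)]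
      positivity
    · rw [Complex.cpow_inv_two_im_eq_neg_sqrt h,
        Complex.cpow_inv_two_im_eq_neg_sqrt (him'.symm ▸ h), neg_mul_neg]
      positivity
  generalize (z + 1) ^ ((1 : ℂ) / 2) = a at *
  generalize z ^ ((1 : ℂ) / 2) = b at *
  have hb0 : 0 < Complex.normSq b := Complex.normSq_pos.2 (by rintro rfl; simp at hb)
  rw [Complex.div_re, ← add_div]
  exact div_pos (by nlinarith [mul_pos ha hb]) hb0

/-- The two-term approximation `√s (1 - 3/(8s))` of `Γ(s)/Γ(s - 1/2)`. -/
noncomputable def approx (s : ℂ) : ℂ := s ^ ((1 : ℂ) / 2) * (1 - 3 / (8 * s))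

theorem affine_norm_bounds {w : ℂ} (hw : 10 ≤ ‖w‖) :
    9 / 10 * ‖w‖ ≤ ‖w + 1‖ ∧ 7 * ‖w‖ ≤ ‖8 * w - 3‖ ∧
      ‖25 - 56 * w‖ ≤ 59 * ‖w‖ ∧ ‖1 - 8 * w‖ ≤ 9 * ‖w‖ := by
  have e8 : ‖8 * w‖ = 8 * ‖w‖ := by simp
  have e56 : ‖56 * w‖ = 56 * ‖w‖ := by simp
  have e3 : ‖(3 : ℂ)‖ = 3 := by simp
  have e25 : ‖(25 : ℂ)‖ = 25 := by simp
  have e1 : ‖(1 : ℂ)‖ = 1 := by simp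
  have h1 : ‖w‖ ≤ ‖w + 1‖ + ‖(1 : ℂ)‖ := by simpa using norm_sub_le (w + 1) 1
  have h2 := norm_sub_norm_le (8 * w) 3
  have h3 := norm_sub_le 25 (56 * w)
  have h4 := norm_sub_le 1 (8 * w)
  refine ⟨?_, ?_, ?_, ?_⟩ <;> linarith

theorem approx_ne_zero {w : ℂ} (hw : 10 ≤ ‖w‖) : approx w ≠ 0 := by
  have hw0 : w ≠ 0 := norm_pos_iff.1 (by linarith)
  have h8 : 8 * w - 3 ≠ 0 := norm_pos_iff.1 (by linarith [(affine_norm_bounds hw).2.1])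
  refine mul_ne_zero (by simp [hw0]) ?_
  rw [one_sub_div (by simpa using hw0)]
  exact div_ne_zero h8 (by simpa using hw0)

theorem norm_step_sub_one_le {w : ℂ} (hw : 10 ≤ ‖w‖) (hs : w ∈ Complex.slitPlane) :
    ‖(w - 1 / 2) / w * (approx (w + 1) / approx w) - 1‖ ≤ 2 / ‖w‖ ^ 3 := by
  obtain ⟨b1, b2, b3, b4⟩ := affine_norm_bounds hw
  have hw0 : w ≠ 0 := norm_pos_iff.1 (by linarith)
  have h1 : w + 1 ≠ 0 := norm_pos_iff.1 (by linarith)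
  have h8 : 8 * w - 3 ≠ 0 := norm_pos_iff.1 (by linarith)
  have h8' : w * 8 - 3 ≠ 0 := by rwa [mul_comm]
  set r := (w + 1) ^ ((1 : ℂ) / 2) / w ^ ((1 : ℂ) / 2) with hr
  set A := (2 * w - 1) * (8 * w + 5) / (2 * (w + 1) * (8 * w - 3)) with hA
  have hrw : w ^ ((1 : ℂ) / 2) ≠ 0 := by simp [hw0]
  have hrho : (w - 1 / 2) / w * (approx (w + 1) / approx w) = A * r := by
    rw [hA, hr, approx, approx, one_sub_div (mul_ne_zero (by norm_num) h1),
      one_sub_div (mul_ne_zero (by norm_num) hw0)]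
    field_simp
    ring
  rw [hrho]
  have hr2 : r ^ 2 = (w + 1) / w := by rw [hr, div_pow, cpow_half_sq, cpow_half_sq]
  have hrre : 0 < r.re := cpow_half_ratio_re_pos hs
  have hr1 : 1 ≤ ‖r + 1‖ := by
    have := Complex.re_le_norm (r + 1)
    simp only [Complex.add_re, Complex.one_re] at this
    linarith
  have hrn : ‖r‖ ≤ 2 := by
    have : ‖r‖ ^ 2 ≤ 2 := by
      rw [← norm_pow, hr2, norm_div, div_le_iff₀ (by linarith)]
      have := norm_add_le w 1
      simp only [norm_one] at this
      linarith
    nlinarith [norm_nonneg r]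
  have hA1 : ‖A - 1‖ ≤ 1 / 10 := by
    have : A - 1 = (1 - 8 * w) / (2 * (w + 1) * (8 * w - 3)) := by
      rw [hA]; field_simp; ring
    rw [this, norm_div, norm_mul, norm_mul, Complex.norm_ofNat,
      div_le_iff₀ (by have := norm_pos_iff.2 h1; have := norm_pos_iff.2 h8; positivity)]
    have : 9 / 10 * ‖w‖ * (7 * ‖w‖) ≤ ‖w + 1‖ * ‖8 * w - 3‖ := by gcongr
    nlinarith
  have hsum : 1 / 2 ≤ ‖A * r + 1‖ := by
    have e : r + 1 = (A * r + 1) - (A - 1) * r := by ring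
    have h := norm_sub_le (A * r + 1) ((A - 1) * r)
    rw [← e, norm_mul] at h
    have : ‖A - 1‖ * ‖r‖ ≤ 1 / 10 * 2 := by gcongr
    linarith
  have hprod : (A * r - 1) * (A * r + 1) = (25 - 56 * w) / (4 * w * (w + 1) * (8 * w - 3) ^ 2) := by
    have : (A * r - 1) * (A * r + 1) = A ^ 2 * r ^ 2 - 1 := by ring
    rw [this, hr2, hA]
    field_simp
    ring
  have hle : ‖A * r - 1‖ * ‖A * r + 1‖ ≤ 1 / ‖w‖ ^ 3 := by
    rw [← norm_mul, hprod, norm_div, norm_mul, norm_mul, norm_mul, norm_pow, Complex.norm_ofNat]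
    have hp : 0 < ‖w‖ := by linarith
    calc ‖25 - 56 * w‖ / (4 * ‖w‖ * ‖w + 1‖ * ‖8 * w - 3‖ ^ 2)
        ≤ (59 * ‖w‖) / (4 * ‖w‖ * (9 / 10 * ‖w‖) * (7 * ‖w‖) ^ 2) := by gcongr
      _ ≤ 1 / ‖w‖ ^ 3 := by
        rw [div_le_div_iff₀ (by positivity) (by positivity)]
        have : 0 < ‖w‖ ^ 4 := by positivity
        nlinarith
  have hd : 2 / ‖w‖ ^ 3 = 2 * (1 / ‖w‖ ^ 3) := by ring
  rw [hd]
  nlinarith [norm_nonneg (A * r - 1)]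

theorem tendsto_approx_div_cpow_half (s : ℂ) :
    Tendsto (fun n : ℕ ↦ approx (s + (n + 1 : ℕ)) / (n : ℂ) ^ ((1 : ℂ) / 2)) atTop (nhds 1) := by
  have hinv : Tendsto (fun n : ℕ ↦ ((n : ℂ))⁻¹) atTop (nhds 0) :=
    tendsto_inv_atTop_nhds_zero_nat
  have hz : Tendsto (fun n : ℕ ↦ 1 + (s + 1) * (n : ℂ)⁻¹) atTop (nhds 1) := by
    simpa using (hinv.const_mul (s + 1)).const_add 1
  have hcpow : Tendsto (fun n : ℕ ↦ (1 + (s + 1) * (n : ℂ)⁻¹) ^ ((1 : ℂ) / 2)) atTop (nhds 1) := by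
    simpa using hz.cpow tendsto_const_nhds Complex.one_mem_slitPlane
  have hfac : Tendsto (fun n : ℕ ↦ 1 - 3 / 8 * ((n : ℂ)⁻¹ * (1 + (s + 1) * (n : ℂ)⁻¹)⁻¹))
      atTop (nhds 1) := by
    simpa using ((hinv.mul (hz.inv₀ one_ne_zero)).const_mul (3 / 8)).const_sub 1
  have hmul := hcpow.mul hfac
  rw [one_mul] at hmul
  refine hmul.congr' ?_
  filter_upwards [eventually_gt_atTop 0, hz.eventually_ne one_ne_zero] with n hn hne
  have hn' : (n : ℂ) ≠ 0 := by exact_mod_cast hn.ne'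
  have e : s + (n + 1 : ℕ) = ((n : ℝ) : ℂ) * (1 + (s + 1) * (n : ℂ)⁻¹) := by
    push_cast
    field_simp
    ring
  have hn2 : (n : ℂ) ^ ((1 : ℂ) / 2) ≠ 0 := by simp [hn']
  rw [approx, e, ofReal_mul_cpow (by exact_mod_cast hn) hne, Complex.ofReal_natCast]
  generalize 1 + (s + 1) * (n : ℂ)⁻¹ = z at *
  field_simp

theorem GammaSeq_div_GammaSeq_sub_half (s : ℂ) {n : ℕ} (hn : n ≠ 0) :
    Complex.GammaSeq s n / Complex.GammaSeq (s - 1 / 2) n =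
      (n : ℂ) ^ ((1 : ℂ) / 2) * ∏ j ∈ Finset.range (n + 1), (s + j - 1 / 2) / (s + j) := by
  have hn' : (n : ℂ) ≠ 0 := by exact_mod_cast hn
  have hf : (n.factorial : ℂ) ≠ 0 := by exact_mod_cast n.factorial_ne_zero
  have hc : (n : ℂ) ^ s ≠ 0 := by simp [hn']
  have hc2 : (n : ℂ) ^ ((1 : ℂ) / 2) ≠ 0 := by simp [hn']
  rw [Complex.GammaSeq, Complex.GammaSeq, Complex.cpow_sub _ _ hn', Finset.prod_div_distrib]
  simp only [sub_add_eq_add_sub]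
  field_simp

theorem sum_inv_cube_le {x : ℝ} (hx : 2 ≤ x) (n : ℕ) :
    ∑ j ∈ Finset.range n, 1 / (x + j) ^ 3 ≤ 4 / x ^ 2 := by
  have key : ∑ j ∈ Finset.range n, 1 / (x + j) ^ 3 ≤ 1 / (x - 1) ^ 2 - 1 / (x + n - 1) ^ 2 := by
    induction n with
    | zero => simp
    | succ n ih =>
      rw [Finset.sum_range_succ]
      have hn : (0 : ℝ) ≤ n := n.cast_nonneg
      have step : 1 / (x + n) ^ 3 ≤ 1 / (x + n - 1) ^ 2 - 1 / (x + (n + 1 : ℕ) - 1) ^ 2 := by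
        push_cast
        rw [show x + ((n : ℝ) + 1) - 1 = x + n by ring]
        set y := x + n with hy
        have hy2 : 2 ≤ y := by linarith
        have : 0 < y - 1 := by linarith
        rw [div_sub_div _ _ (by positivity) (by positivity),
          div_le_div_iff₀ (by positivity) (by positivity)]
        have : 0 ≤ y ^ 2 * (y ^ 2 + y - 1) := mul_nonneg (sq_nonneg y) (by nlinarith)
        nlinarith
      linarith
  have h1 : 0 ≤ 1 / (x + n - 1) ^ 2 := by positivity
  have h2 : 1 / (x - 1) ^ 2 ≤ 4 / x ^ 2 := by
    have : 0 < x - 1 := by linarith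
    rw [div_le_div_iff₀ (by positivity) (by positivity)]
    nlinarith
  linarith

theorem norm_add_natCast_ge {ε : ℝ} (hε0 : 0 ≤ ε) {s : ℂ} (hs : |s.arg| ≤ π - ε)
    (n : ℕ) : sin (ε / 2) * (‖s‖ + n) ≤ ‖s + n‖ := by
  have hre : -(cos ε * ‖s‖) ≤ s.re := by
    have hcos : cos (π - ε) ≤ cos s.arg := by
      rw [← cos_abs s.arg]
      exact cos_le_cos_of_nonneg_of_le_pi (abs_nonneg _) (sub_le_self π hε0) hs
    rw [cos_pi_sub] at hcos
    rw [← Complex.norm_mul_cos_arg s]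
    nlinarith [norm_nonneg s]
  have hε : cos ε = 1 - 2 * sin (ε / 2) ^ 2 := by
    have h1 := cos_two_mul (ε / 2)
    have h2 := sin_sq_add_cos_sq (ε / 2)
    rw [mul_div_cancel₀ _ two_ne_zero] at h1
    linarith
  refine (le_abs_self _).trans (abs_le_of_sq_le_sq ?_ (norm_nonneg _))
  have hn : (0 : ℝ) ≤ n := n.cast_nonneg
  have h1 : ‖s + n‖ ^ 2 = ‖s‖ ^ 2 + 2 * n * s.re + n ^ 2 := by
    rw [Complex.sq_norm, Complex.sq_norm, Complex.normSq_apply, Complex.normSq_apply]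
    simp
    ring
  rw [h1]
  rw [hε] at hre
  have h2 : 0 ≤ (1 - sin (ε / 2) ^ 2) * (‖s‖ - n) ^ 2 :=
    mul_nonneg (by linarith [sin_sq_le_one (ε / 2)]) (sq_nonneg _)
  have h3 := mul_le_mul_of_nonneg_left hre hn
  nlinarith

theorem tendsto_prod_step {s : ℂ} (h10 : ∀ n : ℕ, 10 ≤ ‖s + n‖) :
    Tendsto (fun n : ℕ ↦ ∏ j ∈ Finset.range (n + 1),
        ((s + j - 1 / 2) / (s + j) * (approx (s + j + 1) / approx (s + j))))
      atTop (nhds (Complex.Gamma s / Complex.Gamma (s - 1 / 2) / approx s)) := by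
  have hG : Complex.Gamma (s - 1 / 2) ≠ 0 := by
    refine Complex.Gamma_ne_zero fun m hm ↦ ?_
    have h := h10 m
    rw [show s + m = 1 / 2 by linear_combination hm] at h
    norm_num at h
  have hs0 : approx s ≠ 0 := approx_ne_zero (by simpa using h10 0)
  have hlim := ((((Complex.GammaSeq_tendsto_Gamma s).div
    (Complex.GammaSeq_tendsto_Gamma (s - 1 / 2)) hG).div_const (approx s)).mul
    (tendsto_approx_div_cpow_half s))
  rw [mul_one] at hlim
  refine hlim.congr' ?_
  filter_upwards [eventually_ne_atTop 0] with n hn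
  have hn2 : (n : ℂ) ^ ((1 : ℂ) / 2) ≠ 0 := by simp [hn]
  have htel (m : ℕ) : ∏ j ∈ Finset.range m, approx (s + (j + 1 : ℕ)) / approx (s + j) =
      approx (s + m) / approx s := by
    induction m with
    | zero => simp [hs0]
    | succ m ih =>
      rw [Finset.prod_range_succ, ih, div_mul_div_cancel₀' (approx_ne_zero (h10 m))]
  rw [Pi.div_apply, GammaSeq_div_GammaSeq_sub_half s hn, Finset.prod_mul_distrib]
  simp only [add_assoc, ← Nat.cast_add_one]
  rw [htel]
  field_simp

theorem norm_Gamma_ratio_sub_one_le {s : ℂ} (hs : s ∈ Complex.slitPlane)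
    (h10 : ∀ n : ℕ, 10 ≤ ‖s + n‖) {B : ℝ} (hB : B ≤ 1)
    (hsum : ∀ n : ℕ, ∑ j ∈ Finset.range n, 2 / ‖s + j‖ ^ 3 ≤ B) :
    ‖Complex.Gamma s / Complex.Gamma (s - 1 / 2) / approx s - 1‖ ≤ 2 * B := by
  refine le_of_tendsto ((tendsto_prod_step h10).sub_const 1).norm (Eventually.of_forall fun n ↦ ?_)
  set δ : ℕ → ℂ := fun j ↦
    (s + j - 1 / 2) / (s + j) * (approx (s + j + 1) / approx (s + j)) - 1 with hδ
  have hprod := Finset.norm_prod_one_add_sub_one_le (Finset.range (n + 1)) δ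
  simp only [hδ, add_sub_cancel] at hprod
  have hle : ∑ j ∈ Finset.range (n + 1), ‖δ j‖ ≤ B :=
    (Finset.sum_le_sum fun j _ ↦ norm_step_sub_one_le (h10 j)
      (add_natCast_mem_slitPlane hs j)).trans (hsum _)
  have hB0 : 0 ≤ B := by simpa using hsum 0
  have hexp := abs_exp_sub_one_le (x := B) (by rwa [abs_of_nonneg hB0])
  rw [abs_of_nonneg hB0] at hexp
  calc _ ≤ _ := hprod
    _ ≤ exp B - 1 := by gcongr
    _ ≤ 2 * B := (le_abs_self _).trans hexp

theorem norm_approx_le {s : ℂ} (hs : 10 ≤ ‖s‖) : ‖approx s‖ ≤ 2 * ‖s‖ ^ ((1 : ℝ) / 2) := by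
  have h1 : ‖s ^ ((1 : ℂ) / 2)‖ = ‖s‖ ^ ((1 : ℝ) / 2) := by
    have := Complex.norm_cpow_real s (1 / 2)
    simpa using this
  have h2 : ‖1 - 3 / (8 * s)‖ ≤ 2 := by
    refine (norm_sub_le _ _).trans ?_
    have : 3 / (8 * ‖s‖) ≤ 1 := by
      rw [div_le_one (by linarith)]
      linarith
    rw [norm_div, norm_mul, norm_one, Complex.norm_ofNat, Complex.norm_ofNat]
    linarith
  rw [approx, norm_mul, h1, mul_comm]
  gcongr

theorem mellin_multiplier_asymptotics :
    ∀ ε₀ : ℝ, 0 < ε₀ → ε₀ < π → ∃ C > (0:ℝ), ∃ R > (0:ℝ), ∀ s : ℂ,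
      R ≤ ‖s‖ → |s.arg| ≤ π - ε₀ →
      ‖Mfun s + 2 * (((π : ℝ) : ℂ) * s) ^ ((1:ℂ)/2) * (1 - 3/(8*s))‖
        ≤ C * ‖s‖ ^ (-(3:ℝ)/2) := by
  intro ε h0 hπ
  set c := sin (ε / 2)
  have hc : 0 < c := sin_pos_of_pos_of_lt_pi (by linarith) (by linarith)
  have hc1 : c ≤ 1 := sin_le_one _
  refine ⟨64 * √π / c ^ 3, by positivity, 10 / c ^ 3, by positivity, fun s hR harg ↦ ?_⟩
  have hR' : 10 ≤ c ^ 3 * ‖s‖ := by rwa [div_le_iff₀' (by positivity)] at hR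
  have hc3 : c ^ 3 ≤ c := pow_le_of_le_one hc.le hc1 (by norm_num)
  have hcs : 10 ≤ c * ‖s‖ := hR'.trans (by gcongr)
  have hs10 : 10 ≤ ‖s‖ := hcs.trans (mul_le_of_le_one_left (norm_nonneg _) hc1)
  have hs0 : s ≠ 0 := norm_pos_iff.1 (by linarith)
  have hspos : 0 < ‖s‖ := norm_pos_iff.2 hs0
  have hlow := norm_add_natCast_ge h0.le harg
  have hslit : s ∈ Complex.slitPlane := by
    refine Complex.mem_slitPlane_iff_arg.2 ⟨fun h ↦ ?_, hs0⟩
    rw [h, abs_of_pos pi_pos] at harg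
    linarith
  have h10 (n : ℕ) : 10 ≤ ‖s + n‖ := by
    refine hcs.trans (le_trans ?_ (hlow n))
    gcongr
    simp
  have hsum (n : ℕ) : ∑ j ∈ Finset.range n, 2 / ‖s + j‖ ^ 3 ≤ 8 / (c ^ 3 * ‖s‖ ^ 2) := by
    calc ∑ j ∈ Finset.range n, 2 / ‖s + j‖ ^ 3
        ≤ ∑ j ∈ Finset.range n, 2 / c ^ 3 * (1 / (‖s‖ + j) ^ 3) := by
          refine Finset.sum_le_sum fun j _ ↦ ?_
          rw [div_mul_div_comm, mul_one, ← mul_pow]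
          gcongr
          exact hlow j
      _ ≤ 2 / c ^ 3 * (4 / ‖s‖ ^ 2) := by
          rw [← Finset.mul_sum]
          gcongr
          exact sum_inv_cube_le (by linarith) n
      _ = 8 / (c ^ 3 * ‖s‖ ^ 2) := by ring
  have hB : 8 / (c ^ 3 * ‖s‖ ^ 2) ≤ 1 := by
    rw [div_le_one (by positivity)]
    nlinarith
  have hq := norm_Gamma_ratio_sub_one_le hslit h10 hB hsum
  have hpi : ((π : ℝ) : ℂ) ^ ((1 : ℂ) / 2) = (√π : ℝ) := by
    rw [sqrt_eq_rpow, Complex.ofReal_cpow pi_pos.le]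
    simp
  have ha : approx s ≠ 0 := approx_ne_zero hs10
  have heq : Mfun s + 2 * (((π : ℝ) : ℂ) * s) ^ ((1 : ℂ) / 2) * (1 - 3 / (8 * s)) =
      -2 * (√π : ℝ) * (approx s * (Complex.Gamma s / Complex.Gamma (s - 1 / 2) / approx s - 1)) := by
    rw [ofReal_mul_cpow pi_pos hs0, hpi, mul_sub (approx s), mul_div_cancel₀ _ ha, Mfun, approx]
    ring
  have hpow : ‖s‖ ^ ((1 : ℝ) / 2) / ‖s‖ ^ 2 = ‖s‖ ^ (-(3 : ℝ) / 2) := by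
    rw [← rpow_natCast, ← rpow_sub hspos]
    norm_num
  rw [heq, norm_mul, norm_mul, norm_mul, norm_neg, Complex.norm_ofNat, Complex.norm_real,
    norm_of_nonneg (sqrt_nonneg π)]
  calc 2 * √π * (‖approx s‖ * ‖Complex.Gamma s / Complex.Gamma (s - 1 / 2) / approx s - 1‖)
      ≤ 2 * √π * (2 * ‖s‖ ^ ((1 : ℝ) / 2) * (2 * (8 / (c ^ 3 * ‖s‖ ^ 2)))) := by
        gcongr
        exact norm_approx_le hs10
    _ = 64 * √π / c ^ 3 * (‖s‖ ^ ((1 : ℝ) / 2) / ‖s‖ ^ 2) := by ring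
    _ = 64 * √π / c ^ 3 * ‖s‖ ^ (-(3 : ℝ) / 2) := by rw [hpow]
end

section
/- For η ∈ ℝ let √(iη) denote the principal square root, so that Re √(iη) = √(|η|/2) for η ≠ 0. Then for every χ ∈ ℝ the function η ↦ e^{iηχ} e^{−2√(π i η)} is absolutely integrable on ℝ, and: (i) ∫_{−∞}^{∞} e^{iηχ} e^{−2√(π i η)} dη = 0 for every χ < 0; (ii) for every χ > 0, ∫_{−∞}^{∞} e^{iηχ} e^{−2√(π i η)} dη = 2 ∫₀^∞ e^{−χu} sin(2√(πu)) du = 2π χ^{−3/2} e^{−π/χ}; in particular ∫₀^∞ e^{−χu} sin(2√(πu)) du = π χ^{−3/2} e^{−π/χ} for every χ > 0. -/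
open MeasureTheory Real Set Filter

lemma integrableOn_Ioi_of_norm_le_mul_exp {f : ℝ → ℂ} (hf : Continuous f) {K δ : ℝ}
    (hδ : 0 < δ) (hbound : ∀ v : ℝ, 1 ≤ v → ‖f v‖ ≤ K * (v * Real.exp (-δ * v))) :
    IntegrableOn f (Ioi 0) := by
  have hcomp : ∀ v : ℝ, 1 ≤ v → v * Real.exp (-δ * v) ≤ (2 / δ) * Real.exp (-(δ / 2) * v) := by
    intro v _
    have h1 : δ / 2 * v ≤ Real.exp (δ / 2 * v) := by
      linarith [Real.add_one_le_exp (δ / 2 * v)]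
    have h2 : Real.exp (-δ * v) = Real.exp (-(δ / 2) * v) * Real.exp (-(δ / 2 * v)) := by
      rw [← Real.exp_add]; ring_nf
    have h3 : v * Real.exp (-(δ / 2 * v)) ≤ 2 / δ := by
      rw [Real.exp_neg, ← div_eq_mul_inv, div_le_iff₀ (Real.exp_pos _)]
      calc v = 2 / δ * (δ / 2 * v) := by field_simp
        _ ≤ _ := by gcongr
    rw [h2]
    nlinarith [Real.exp_pos (-(δ / 2) * v)]
  refine (integrableOn_Ici_iff_integrableOn_Ioi (by finiteness)).mp ?_
  refine (hf.locallyIntegrable.locallyIntegrableOn _).integrableOn_of_isBigO_atTop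
    (g := fun v => Real.exp (-(δ / 2) * v)) ?_ ?_
  · refine Asymptotics.IsBigO.of_bound (|K| * (2 / δ)) ?_
    filter_upwards [eventually_ge_atTop 1] with v hv
    rw [Real.norm_of_nonneg (Real.exp_pos _).le, mul_assoc]
    refine (hbound v hv).trans ?_
    have := hcomp v hv
    have h0 : 0 ≤ v * Real.exp (-δ * v) := by positivity
    exact mul_le_mul (le_abs_self K) this h0 (abs_nonneg K)
  · exact ⟨Ioi 0, Ioi_mem_atTop 0, exp_neg_integrableOn_Ioi 0 (by positivity)⟩

lemma integral_ray_eq_of_decay {g : ℂ → ℂ} (hg : Differentiable ℂ g) {a c : ℂ} {K δ : ℝ}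
    (hδ : 0 < δ)
    (hbound : ∀ z ∈ segment ℝ a c, ∀ v : ℝ, 1 ≤ v → ‖g (z * v)‖ ≤ K * (v * Real.exp (-δ * v))) :
    ∫ v in Ioi (0 : ℝ), a * g (a * v) = ∫ v in Ioi (0 : ℝ), c * g (c * v) := by
  obtain ⟨P, hP⟩ := hg.isExactOn_univ
  have hint : ∀ z ∈ segment ℝ a c, IntegrableOn (fun v : ℝ => z * g (z * v)) (Ioi 0) := by
    intro z hz
    refine (integrableOn_Ioi_of_norm_le_mul_exp ?_ hδ (hbound z hz)).const_mul z
    exact hg.continuous.comp (by fun_prop)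
  have hfin : ∀ (z : ℂ) (V : ℝ), ∫ v in (0 : ℝ)..V, z * g (z * v) = P (z * V) - P 0 := by
    intro z V
    have hd : ∀ v ∈ uIcc (0 : ℝ) V, HasDerivAt (fun v : ℝ => P (z * v)) (z * g (z * v)) v := by
      intro v _
      have h1 : HasDerivAt (fun w : ℂ => z * w) z (v : ℂ) := by
        simpa using (hasDerivAt_id (v : ℂ)).const_mul z
      have h2 := ((hP (z * v) (mem_univ _)).comp (v : ℂ) h1).comp_ofReal
      rw [mul_comm] at h2
      exact h2
    rw [intervalIntegral.integral_eq_sub_of_hasDerivAt hd]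
    · simp
    · apply Continuous.intervalIntegrable
      exact continuous_const.mul (hg.continuous.comp (by fun_prop))
  have hlim : ∀ z ∈ segment ℝ a c, Tendsto (fun V : ℝ => P (z * V) - P 0) atTop
      (nhds (∫ v in Ioi (0 : ℝ), z * g (z * v))) := by
    intro z hz
    have := intervalIntegral_tendsto_integral_Ioi 0 (hint z hz) tendsto_id
    simpa only [hfin, id] using this
  have h0 := (hlim c (right_mem_segment ℝ a c)).sub (hlim a (left_mem_segment ℝ a c))
  have hdiff : Tendsto (fun V : ℝ => (P (c * V) - P 0) - (P (a * V) - P 0)) atTop (nhds 0) := by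
    have hb : Tendsto (fun V : ℝ => K * (V ^ 2 * Real.exp (-δ * V)) * ‖c - a‖) atTop (nhds 0) := by
      have h := (Real.tendsto_pow_mul_exp_neg_atTop_nhds_zero 2).comp
        (tendsto_id.const_mul_atTop hδ)
      have h' := (h.const_mul (K * (1 / δ ^ 2))).mul_const ‖c - a‖
      simp only [mul_zero, zero_mul] at h'
      refine h'.congr fun V => ?_
      simp only [Function.comp, id]
      field_simp
    refine squeeze_zero_norm' ?_ hb
    filter_upwards [eventually_ge_atTop 1] with V hV
    rw [sub_sub_sub_cancel_right]
    refine (convex_segment (𝕜 := ℝ) a c).norm_image_sub_le_of_norm_hasDerivWithin_le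
      (𝕜 := ℂ) (f := fun z : ℂ => P (z * V)) (f' := fun z => g (z * V) * V) ?_ ?_
      (left_mem_segment ℝ a c) (right_mem_segment ℝ a c)
    · intro z _
      have h1 : HasDerivAt (fun w : ℂ => w * V) (V : ℂ) z := by
        simpa using (hasDerivAt_id z).mul_const (V : ℂ)
      exact ((hP (z * V) (mem_univ _)).comp z h1).hasDerivWithinAt
    · intro z hz
      have := hbound z hz V hV
      rw [norm_mul, Complex.norm_real, Real.norm_of_nonneg (by linarith)]
      nlinarith
  exact (sub_eq_zero.mp (tendsto_nhds_unique h0 hdiff)).symm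

/-- The integrand obtained from `η ↦ exp (iηχ - b√(iη))` by substituting `w = √(iη)`. -/
noncomputable def rayKernel (χ b : ℝ) (w : ℂ) : ℂ := 2 * w * Complex.exp (χ * w ^ 2 - b * w)

lemma differentiable_rayKernel (χ b : ℝ) : Differentiable ℂ (rayKernel χ b) := by
  unfold rayKernel
  fun_prop

lemma norm_rayKernel_le {χ b M δ : ℝ} {z : ℂ} (hz : ‖z‖ ≤ M) {v : ℝ} (hv : 0 ≤ v)
    (h : χ * (z ^ 2).re * v ^ 2 - b * z.re * v ≤ -δ * v) :
    ‖rayKernel χ b (z * v)‖ ≤ 2 * M * (v * Real.exp (-δ * v)) := by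
  have hre : ((χ : ℂ) * (z * v) ^ 2 - b * (z * v)).re
      = χ * (z ^ 2).re * v ^ 2 - b * z.re * v := by
    simp [pow_two]
    ring
  rw [rayKernel, norm_mul, Complex.norm_exp, hre, norm_mul, norm_mul, Complex.norm_real,
    Real.norm_of_nonneg hv, Complex.norm_ofNat]
  have := Real.exp_le_exp.mpr h
  have hM : 0 ≤ M := (norm_nonneg z).trans hz
  rw [mul_assoc (2 : ℝ)]
  calc 2 * (‖z‖ * v * _) ≤ 2 * (M * v * Real.exp (-δ * v)) := by gcongr
    _ = _ := by ring

lemma integrableOn_rayKernel_diagonal (χ : ℝ) {b : ℝ} (hb : 0 < b) :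
    IntegrableOn (fun v : ℝ => rayKernel χ b ((1 + Complex.I) * v)) (Ioi 0) := by
  refine integrableOn_Ioi_of_norm_le_mul_exp (K := 2 * ‖1 + Complex.I‖) ?_ hb ?_
  · exact (differentiable_rayKernel χ b).continuous.comp (by fun_prop)
  · intro v hv
    refine norm_rayKernel_le le_rfl (by linarith) ?_
    simp [pow_two]

lemma integral_rayKernel_of_neg {χ b : ℝ} (hχ : χ ≤ 0) (hb : 0 < b) :
    ∫ v in Ioi (0 : ℝ), (1 + Complex.I) * rayKernel χ b ((1 + Complex.I) * v)
      = ∫ v in Ioi (0 : ℝ), rayKernel χ b v := by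
  have := integral_ray_eq_of_decay (differentiable_rayKernel χ b) (a := 1 + Complex.I) (c := 1)
    (K := 2 * 2) hb ?_
  · simpa using this
  rintro z hz v hv
  rw [segment_eq_image] at hz
  obtain ⟨t, ⟨ht0, ht1⟩, rfl⟩ := hz
  refine norm_rayKernel_le ?_ (by linarith) ?_
  · refine (Complex.norm_le_abs_re_add_abs_im _).trans ?_
    simp
    rw [abs_of_nonneg (by linarith)]
    linarith
  · simp [pow_two]
    have : 0 ≤ 1 - (1 - t) * (1 - t) := by nlinarith
    nlinarith [mul_nonneg this (mul_nonneg (neg_nonneg.mpr hχ) (mul_self_nonneg v))]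

lemma integral_rayKernel_of_pos {χ b : ℝ} (hχ : 0 < χ) (hb : 0 < b) :
    ∫ v in Ioi (0 : ℝ), (1 + Complex.I) * rayKernel χ b ((1 + Complex.I) * v)
      = ∫ v in Ioi (0 : ℝ), Complex.I * rayKernel χ b (Complex.I * v) := by
  refine integral_ray_eq_of_decay (differentiable_rayKernel χ b) (a := 1 + Complex.I)
    (c := Complex.I) (K := 2 * 2) (δ := min χ b) (lt_min hχ hb) ?_
  rintro z hz v hv
  rw [segment_eq_image] at hz
  obtain ⟨t, ⟨ht0, ht1⟩, rfl⟩ := hz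
  refine norm_rayKernel_le ?_ (by linarith) ?_
  · refine (Complex.norm_le_abs_re_add_abs_im _).trans ?_
    simp
    rw [abs_of_nonneg (by linarith)]
    linarith
  · simp [pow_two]
    set m := min χ b
    have hm : 0 < m := lt_min hχ hb
    have h1 : m ≤ χ := min_le_left _ _
    have h2 : m ≤ b := min_le_right _ _
    have hs : 0 ≤ 1 - (1 - t) * (1 - t) := by nlinarith
    have h3 : m * v ≤ χ * (v * v) := by
      have : v ≤ v * v := by nlinarith
      have : 0 ≤ v := by linarith
      gcongr
    have h4 : m * v ≤ b * v := by nlinarith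
    have h5 := mul_le_mul_of_nonneg_left h3 hs
    have h6 := mul_le_mul_of_nonneg_left h4 (sub_nonneg.mpr ht1)
    have h7 : 0 ≤ m * v * (t * (1 - t)) := by
      have := sub_nonneg.mpr ht1
      positivity
    nlinarith

lemma integral_Ioi_exp_neg_mul_sq_mul_cos {χ : ℝ} (hχ : 0 < χ) (b : ℝ) :
    ∫ v in Ioi (0 : ℝ), Real.exp (-χ * v ^ 2) * Real.cos (b * v)
      = 1 / 2 * (√(π / χ) * Real.exp (-b ^ 2 / (4 * χ))) := by
  have h1 := fourierIntegral_gaussian (b := (χ : ℂ)) (by simpa using hχ) (b : ℂ)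
  have hi : Integrable fun x : ℝ =>
      Complex.exp (Complex.I * b * x) * Complex.exp (-(χ : ℂ) * x ^ 2) := by
    refine (GaussianFourier.integrable_cexp_neg_mul_sq_add_real_mul_I (b := (χ : ℂ))
      (by simpa using hχ) 0).mono (by fun_prop) (ae_of_all _ fun x => ?_)
    simp [Complex.norm_exp]
  have h2 := integral_re hi
  rw [h1] at h2
  have h3 : ∀ x : ℝ, RCLike.re (Complex.exp (Complex.I * b * x) * Complex.exp (-(χ : ℂ) * x ^ 2))
      = Real.exp (-χ * |x| ^ 2) * Real.cos (b * |x|) := by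
    intro x
    have hc : Real.cos (b * |x|) = Real.cos (b * x) := by
      rcases abs_choice x with h | h <;> simp [h]
    rw [hc, sq_abs, ← Complex.exp_add]
    simp [Complex.exp_re, pow_two]
  simp_rw [h3] at h2
  rw [integral_comp_abs (f := fun x => Real.exp (-χ * x ^ 2) * Real.cos (b * x))] at h2
  have h4 : ((π : ℂ) / χ) ^ (1 / 2 : ℂ) * Complex.exp (-(b : ℂ) ^ 2 / (4 * χ))
      = ((√(π / χ) * Real.exp (-b ^ 2 / (4 * χ)) : ℝ) : ℂ) := by
    rw [Real.sqrt_eq_rpow]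
    push_cast [Complex.ofReal_cpow (div_pos pi_pos hχ).le]
    rfl
  rw [h4] at h2
  have h5 : RCLike.re ((√(π / χ) * Real.exp (-b ^ 2 / (4 * χ)) : ℝ) : ℂ)
    = √(π / χ) * Real.exp (-b ^ 2 / (4 * χ)) := Complex.ofReal_re _
  rw [h5] at h2
  linarith

lemma integrable_two_mul_exp_mul_sin {χ : ℝ} (hχ : 0 < χ) (b : ℝ) :
    Integrable fun v : ℝ => 2 * v * Real.exp (-χ * v ^ 2) * Real.sin (b * v) := by
  refine ((integrable_mul_exp_neg_mul_sq hχ).const_mul 2).mono (by fun_prop)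
    (ae_of_all _ fun v => ?_)
  rw [norm_mul, mul_assoc]
  exact mul_le_of_le_one_right (norm_nonneg _) (Real.abs_sin_le_one _)

lemma integral_two_mul_exp_mul_sin {χ : ℝ} (hχ : 0 < χ) (b : ℝ) :
    ∫ v in Ioi (0 : ℝ), 2 * v * Real.exp (-χ * v ^ 2) * Real.sin (b * v)
      = b / (2 * χ) * (√(π / χ) * Real.exp (-b ^ 2 / (4 * χ))) := by
  have hic : Integrable fun v : ℝ => Real.exp (-χ * v ^ 2) * Real.cos (b * v) := by
    refine (integrable_exp_neg_mul_sq hχ).mono (by fun_prop) (ae_of_all _ fun v => ?_)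
    rw [norm_mul]
    exact mul_le_of_le_one_right (norm_nonneg _) (Real.abs_cos_le_one _)
  have his := integrable_two_mul_exp_mul_sin hχ b
  have hd : ∀ v ∈ Ici (0 : ℝ), HasDerivAt
      (fun v => -(1 / χ) * (Real.exp (-χ * v ^ 2) * Real.sin (b * v)))
      (2 * v * Real.exp (-χ * v ^ 2) * Real.sin (b * v)
        - b / χ * (Real.exp (-χ * v ^ 2) * Real.cos (b * v))) v := by
    intro v _
    have h1 : HasDerivAt (fun v : ℝ => -χ * v ^ 2) (-χ * (2 * v)) v := by
      simpa using (hasDerivAt_pow 2 v).const_mul (-χ)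
    have h2 : HasDerivAt (fun v : ℝ => b * v) b v := by
      simpa using (hasDerivAt_id v).const_mul b
    refine ((h1.exp.mul h2.sin).const_mul (-(1 / χ))).congr_deriv ?_
    field_simp
    ring
  have hlim : Tendsto (fun v => -(1 / χ) * (Real.exp (-χ * v ^ 2) * Real.sin (b * v))) atTop
      (nhds 0) := by
    have he : Tendsto (fun v : ℝ => Real.exp (-χ * v ^ 2)) atTop (nhds 0) :=
      Real.tendsto_exp_atBot.comp
        ((tendsto_pow_atTop two_ne_zero).const_mul_atTop_of_neg (neg_lt_zero.mpr hχ))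
    have := (squeeze_zero_norm (fun v => ?_) he :
      Tendsto (fun v => Real.exp (-χ * v ^ 2) * Real.sin (b * v)) atTop (nhds 0))
    · simpa using this.const_mul (-(1 / χ))
    · rw [norm_mul, Real.norm_of_nonneg (Real.exp_pos _).le]
      exact mul_le_of_le_one_right (Real.exp_pos _).le (Real.abs_sin_le_one _)
  have h := integral_Ioi_of_hasDerivAt_of_tendsto' hd
    (his.sub (hic.const_mul (b / χ))).integrableOn hlim
  rw [integral_sub his.integrableOn (hic.const_mul (b / χ)).integrableOn, integral_const_mul,
    integral_Ioi_exp_neg_mul_sq_mul_cos hχ b] at h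
  simp only [mul_zero, Real.sin_zero, sub_zero] at h
  rw [sub_eq_zero.mp h]
  ring

lemma integral_exp_mul_sin_sqrt_eq (χ : ℝ) :
    ∫ u in Ioi (0 : ℝ), Real.exp (-χ * u) * Real.sin (2 * √(π * u))
      = ∫ v in Ioi (0 : ℝ), 2 * v * Real.exp (-χ * v ^ 2) * Real.sin (2 * √π * v) := by
  rw [← integral_comp_rpow_Ioi_of_pos two_pos]
  refine setIntegral_congr_fun measurableSet_Ioi fun v hv => ?_
  have hv' : (0 : ℝ) ≤ v := le_of_lt hv
  simp only [smul_eq_mul, Real.rpow_two]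
  rw [Real.sqrt_mul pi_pos.le, Real.sqrt_sq hv', show (2 : ℝ) - 1 = 1 by norm_num, Real.rpow_one]
  ring_nf

lemma integral_exp_mul_sin_sqrt {χ : ℝ} (hχ : 0 < χ) :
    ∫ u in Ioi (0 : ℝ), Real.exp (-χ * u) * Real.sin (2 * √(π * u))
      = π * χ ^ (-(3 : ℝ) / 2) * Real.exp (-π / χ) := by
  rw [integral_exp_mul_sin_sqrt_eq, integral_two_mul_exp_mul_sin hχ]
  have h1 : χ ^ (-(3 : ℝ) / 2) = 1 / (χ * √χ) := by
    rw [Real.sqrt_eq_rpow, show -(3 : ℝ) / 2 = -(1 + 1 / 2) by norm_num, Real.rpow_neg hχ.le,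
      Real.rpow_add hχ, Real.rpow_one, one_div (χ * _)]
  have h2 : -(2 * √π) ^ 2 / (4 * χ) = -π / χ := by
    rw [mul_pow, Real.sq_sqrt pi_pos.le]
    field_simp
    norm_num
  rw [h1, h2, Real.sqrt_div pi_pos.le]
  have := Real.sqrt_pos.mpr hχ
  field_simp
  rw [Real.sq_sqrt pi_pos.le]

/-- The function `η ↦ exp (iηχ) exp (-2√(πiη))`. -/
noncomputable def expSqrtIntegrand (χ η : ℝ) : ℂ :=
  Complex.exp (Complex.I * (η : ℂ) * (χ : ℂ))
    * Complex.exp (-2 * ((Real.pi : ℂ) * Complex.I * (η : ℂ)) ^ ((1:ℂ)/2))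

lemma expSqrtIntegrand_neg (χ η : ℝ) :
    expSqrtIntegrand χ (-η) = (starRingEnd ℂ) (expSqrtIntegrand χ η) := by
  have harg : ((π : ℂ) * Complex.I * η).arg ≠ π := by
    rw [Ne, Complex.arg_eq_pi_iff]
    simp
  have h1 := Complex.conj_cpow _ ((1 : ℂ) / 2) harg
  have h2 : (starRingEnd ℂ) ((π : ℂ) * Complex.I * η) = (π : ℂ) * Complex.I * (-η : ℝ) := by
    simp
  have h4 : (starRingEnd ℂ) 2 = 2 := map_ofNat _ 2
  have h3 : (starRingEnd ℂ) ((1 : ℂ) / 2) = (1 : ℂ) / 2 := by simp [h4]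
  rw [h2, h3] at h1
  unfold expSqrtIntegrand
  rw [h1, map_mul, ← Complex.exp_conj, ← Complex.exp_conj]
  simp [h4]

lemma ray_mul_rayKernel_eq (χ : ℝ) {v : ℝ} (hv : 0 < v) :
    (1 + Complex.I) * rayKernel χ (2 * √π) ((1 + Complex.I) * v)
      = (2 * Complex.I) * ((2 * v ^ ((2 : ℝ) - 1)) • expSqrtIntegrand χ (2 * v ^ (2 : ℝ))) := by
  have hI : (1 + Complex.I) ^ 2 = 2 * Complex.I := by
    linear_combination Complex.I_sq
  have hsqrt : ((π : ℂ) * Complex.I * (2 * v ^ (2 : ℝ) : ℝ)) ^ ((1 : ℂ) / 2)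
      = √π * ((1 + Complex.I) * v) := by
    have hp : ((√π : ℝ) : ℂ) ^ 2 = π := by
      rw [← Complex.ofReal_pow, Real.sq_sqrt pi_pos.le]
    have : (π : ℂ) * Complex.I * (2 * v ^ (2 : ℝ) : ℝ) = (√π * ((1 + Complex.I) * v)) ^ 2 := by
      rw [mul_pow, mul_pow, hI, hp, Real.rpow_two]
      push_cast
      ring
    rw [this, one_div, Complex.sq_cpow_two_inv]
    simp
    positivity
  unfold expSqrtIntegrand rayKernel
  rw [hsqrt, ← Complex.exp_add, show (2 : ℝ) - 1 = 1 by norm_num, Real.rpow_one, Real.rpow_two,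
    Complex.real_smul, mul_pow, hI]
  have he : (χ : ℂ) * (2 * Complex.I * v ^ 2) - (2 * √π : ℝ) * ((1 + Complex.I) * v)
      = Complex.I * (2 * v ^ 2 : ℝ) * χ + -2 * (√π * ((1 + Complex.I) * v)) := by
    push_cast
    ring
  rw [he]
  push_cast
  linear_combination (2 * (v : ℂ) * Complex.exp (Complex.I * (2 * v ^ 2) * χ
    + -2 * (√π * ((1 + Complex.I) * v)))) * hI

lemma integrableOn_Ioi_expSqrtIntegrand (χ : ℝ) :
    IntegrableOn (expSqrtIntegrand χ) (Ioi 0) := by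
  have h := integrableOn_Ioi_comp_mul_left_iff (expSqrtIntegrand χ) 0 two_pos
  rw [mul_zero] at h
  rw [← h, ← integrableOn_Ioi_comp_rpow_iff _ (two_ne_zero : (2 : ℝ) ≠ 0)]
  have hb : 0 < 2 * √π := by positivity
  refine IntegrableOn.congr_fun (((integrableOn_rayKernel_diagonal χ hb).const_mul
    (1 + Complex.I)).const_mul (2 * Complex.I)⁻¹) (fun v hv => ?_) measurableSet_Ioi
  have h2 : 2 * Complex.I ≠ 0 := by simp
  rw [ray_mul_rayKernel_eq χ hv, inv_mul_cancel_left₀ h2, abs_two]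

lemma integral_Ioi_expSqrtIntegrand (χ : ℝ) :
    Complex.I * ∫ η in Ioi (0 : ℝ), expSqrtIntegrand χ η
      = ∫ v in Ioi (0 : ℝ), (1 + Complex.I) * rayKernel χ (2 * √π) ((1 + Complex.I) * v) := by
  have h := integral_comp_mul_left_Ioi' (expSqrtIntegrand χ) 0 two_pos
  rw [mul_zero] at h
  rw [setIntegral_congr_fun measurableSet_Ioi fun v hv => ray_mul_rayKernel_eq χ hv,
    integral_const_mul,
    integral_comp_rpow_Ioi_of_pos (g := fun x => expSqrtIntegrand χ (2 * x)) two_pos, ← h,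
    Complex.real_smul]
  push_cast
  ring

lemma integrable_expSqrtIntegrand (χ : ℝ) : Integrable (expSqrtIntegrand χ) := by
  have h := integrableOn_Ioi_expSqrtIntegrand χ
  have hconj : IntegrableOn (fun η => expSqrtIntegrand χ (-η)) (Ioi (-0)) := by
    simp only [expSqrtIntegrand_neg, neg_zero]
    exact (Complex.conjLIE.toContinuousLinearEquiv.toContinuousLinearMap).integrable_comp h
  have h' := (integrableOn_Iic_iff_integrableOn_Iio (by finiteness)).mpr hconj.comp_neg_Iio
  simp only [neg_neg] at h'
  rw [← integrableOn_univ, ← Iic_union_Ioi (a := (0 : ℝ))]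
  exact h'.union h

lemma integral_expSqrtIntegrand (χ : ℝ) :
    ∫ η, expSqrtIntegrand χ η = ((2 * (∫ η in Ioi (0 : ℝ), expSqrtIntegrand χ η).re : ℝ) : ℂ) := by
  have hi := integrable_expSqrtIntegrand χ
  have hneg : ∫ η in Iic (0 : ℝ), expSqrtIntegrand χ η
      = (starRingEnd ℂ) (∫ η in Ioi (0 : ℝ), expSqrtIntegrand χ η) := by
    have := integral_comp_neg_Ioi 0 (expSqrtIntegrand χ)
    rw [neg_zero] at this
    rw [← this, ← integral_conj]
    simp only [expSqrtIntegrand_neg]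
  rw [← intervalIntegral.integral_Iic_add_Ioi (b := 0) hi.integrableOn hi.integrableOn, hneg,
    add_comm, Complex.add_conj]

lemma integral_expSqrtIntegrand_of_neg {χ : ℝ} (hχ : χ < 0) :
    ∫ η, expSqrtIntegrand χ η = 0 := by
  have h := integral_Ioi_expSqrtIntegrand χ
  have hb : 0 < 2 * √π := by positivity
  have hreal : ∀ v : ℝ, rayKernel χ (2 * √π) v
      = ((2 * v * Real.exp (χ * v ^ 2 - 2 * √π * v) : ℝ) : ℂ) := by
    intro v
    simp [rayKernel]
  rw [integral_rayKernel_of_neg hχ.le hb] at h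
  simp_rw [hreal] at h
  rw [integral_complex_ofReal] at h
  have him := congrArg Complex.im h
  rw [Complex.I_mul_im, Complex.ofReal_im] at him
  rw [integral_expSqrtIntegrand, him]
  simp

lemma integral_expSqrtIntegrand_of_pos {χ : ℝ} (hχ : 0 < χ) :
    ∫ η, expSqrtIntegrand χ η
      = 2 * ((∫ u in Ioi (0 : ℝ), Real.exp (-χ * u) * Real.sin (2 * √(π * u)) : ℝ) : ℂ) := by
  have h := integral_Ioi_expSqrtIntegrand χ
  have hb : 0 < 2 * √π := by positivity
  rw [integral_rayKernel_of_pos hχ hb, integral_const_mul] at h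
  have h' := mul_left_cancel₀ Complex.I_ne_zero h
  have hre : ∀ v : ℝ, RCLike.re (rayKernel χ (2 * √π) (Complex.I * v))
      = 2 * v * Real.exp (-χ * v ^ 2) * Real.sin (2 * √π * v) := by
    intro v
    simp [rayKernel, Complex.exp_re, Complex.exp_im, pow_two, mul_assoc]
  have hint : IntegrableOn (fun v : ℝ => rayKernel χ (2 * √π) (Complex.I * v)) (Ioi 0) := by
    refine Integrable.mono ((integrable_mul_exp_neg_mul_sq hχ).const_mul 2).integrableOn
      ((differentiable_rayKernel χ _).continuous.comp (by fun_prop)).aestronglyMeasurable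
      (ae_of_all _ fun v => le_of_eq ?_)
    simp [rayKernel, Complex.norm_exp, pow_two, mul_assoc]
  have h2 := integral_re hint
  simp_rw [hre] at h2
  rw [integral_expSqrtIntegrand, h', integral_exp_mul_sin_sqrt_eq, h2]
  push_cast
  rfl

theorem fourier_inversion_of_exp_sqrt (χ : ℝ) :
    Integrable (fun η : ℝ =>
      Complex.exp (Complex.I * (η : ℂ) * (χ : ℂ))
        * Complex.exp (-2 * ((Real.pi : ℂ) * Complex.I * (η : ℂ)) ^ ((1:ℂ)/2))) ∧
    (χ < 0 →
      (∫ η : ℝ, Complex.exp (Complex.I * (η : ℂ) * (χ : ℂ))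
        * Complex.exp (-2 * ((Real.pi : ℂ) * Complex.I * (η : ℂ)) ^ ((1:ℂ)/2))) = 0) ∧
    (0 < χ →
      (∫ η : ℝ, Complex.exp (Complex.I * (η : ℂ) * (χ : ℂ))
          * Complex.exp (-2 * ((Real.pi : ℂ) * Complex.I * (η : ℂ)) ^ ((1:ℂ)/2)))
        = 2 * ((∫ u in Ioi (0:ℝ), Real.exp (-χ * u) * Real.sin (2 * Real.sqrt (π * u)) : ℝ) : ℂ) ∧
      (∫ η : ℝ, Complex.exp (Complex.I * (η : ℂ) * (χ : ℂ))
          * Complex.exp (-2 * ((Real.pi : ℂ) * Complex.I * (η : ℂ)) ^ ((1:ℂ)/2)))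
        = ((2 * π * χ ^ (-(3:ℝ)/2) * Real.exp (-π / χ) : ℝ) : ℂ) ∧
      (∫ u in Ioi (0:ℝ), Real.exp (-χ * u) * Real.sin (2 * Real.sqrt (π * u)))
        = π * χ ^ (-(3:ℝ)/2) * Real.exp (-π / χ)) := by
  refine ⟨integrable_expSqrtIntegrand χ, integral_expSqrtIntegrand_of_neg, fun hχ => ?_⟩
  have h1 := integral_expSqrtIntegrand_of_pos hχ
  have h2 := integral_exp_mul_sin_sqrt hχ
  refine ⟨h1, h1.trans ?_, h2⟩
  rw [h2]
  push_cast
  ring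
end
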